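/- Let Ω ⊆ ℂⁿ be a bounded domain. The automorphism group Aut(Ω), regarded as a subset of the space C(Ω, ℂⁿ) of continuous maps with the compact-open topology, fails to be compact if and only if there exist a point P ∈ Ω, a boundary point X ∈ ∂Ω (the topological frontier of Ω), and a sequence of automorphisms φⱼ of Ω such that φⱼ(P) → X as j → ∞. -/

import Mathlib

/-- The subset of `C(Ω, ℂⁿ)` (with the compact-open topology) consisting of the
restrictions to `Ω` of the holomorphic automorphisms of `Ω`. -/
def AutRestrictions (n : ℕ) (Ω : Set (Fin n → ℂ)) : Set C(↥Ω, Fin n → ℂ) :=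
  {f | ∃ φ : (Fin n → ℂ) → (Fin n → ℂ),
    DifferentiableOn ℂ φ Ω ∧ Set.BijOn φ Ω Ω ∧ ∀ z : ↥Ω, f z = φ ↑z}

section

open Filter Metric Set Topology

section Holomorphic

variable {E F : Type*} [NormedAddCommGroup E] [NormedSpace ℂ E] [NormedAddCommGroup F]
  [NormedSpace ℂ F]

/-- Weierstrass' theorem: a uniform limit of holomorphic maps on a ball is differentiable at the
center. -/
theorem TendstoUniformlyOn.differentiableAt_complex [CompleteSpace F] {ι : Type*} {l : Filter ι}
    [l.NeBot] {f : ι → E → F} {g : E → F} {x : E} {r : ℝ} (hr : 0 < r)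
    (hf : ∀ᶠ i in l, DifferentiableOn ℂ (f i) (ball x r))
    (hfg : TendstoUniformlyOn f g l (ball x r)) : DifferentiableAt ℂ g x := by
  have hsub : ∀ y ∈ ball x (r / 2), ball y (r / 2) ⊆ ball x r := fun y hy ↦
    ball_subset_ball' (by have := mem_ball.1 hy; linarith)
  have hC : UniformCauchySeqOn (fun i ↦ fderiv ℂ (f i)) l (ball x (r / 2)) := by
    intro u hu
    obtain ⟨ε, hε, hεu⟩ := Metric.mem_uniformity_dist.1 hu
    have hδ : 0 < ε * r / 16 := by positivity
    filter_upwards [hfg.uniformCauchySeqOn _ (dist_mem_uniformity hδ), hf.prod_mk hf]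
      with n hn hd y hy
    have hy' : y ∈ ball x r := hsub y hy (mem_ball_self (by positivity))
    have hd₁ := hd.1.differentiableAt (isOpen_ball.mem_nhds hy')
    have hd₂ := hd.2.differentiableAt (isOpen_ball.mem_nhds hy')
    apply hεu
    rw [dist_eq_norm, ← fderiv_sub hd₁ hd₂]
    refine (Complex.norm_fderiv_le_div_of_mapsTo_ball (R₂ := ε * r / 8)
      ((hd.1.sub hd.2).mono (hsub y hy)) (fun z hz ↦ ?_) (by positivity)).trans_lt ?_
    · have h₁ := hn z (hsub y hy hz)
      have h₂ := hn y hy'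
      simp only [dist_eq_norm] at h₁ h₂
      rw [mem_closedBall, dist_eq_norm]
      refine (norm_sub_le _ _).trans ?_
      simp only [Pi.sub_apply]
      linarith
    · rw [div_lt_iff₀ (by positivity)]
      nlinarith [mul_pos hε hr]
  have hlim : ∀ y ∈ ball x (r / 2), ∃ L, Tendsto (fun i ↦ fderiv ℂ (f i) y) l (𝓝 L) := fun y hy ↦
    cauchy_map_iff_exists_tendsto.1 (hC.cauchy_map hy)
  choose! g' hg' using hlim
  have hU := hC.tendstoUniformlyOn_of_tendsto hg'
  have hx : ball x (r / 2) ∈ 𝓝 x := ball_mem_nhds x (by positivity)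
  refine (hasFDerivAt_of_tendstoUniformlyOnFilter (l := l) (f := f) (g' := g')
    (f' := fun i ↦ fderiv ℂ (f i)) ?_ ?_ ?_).differentiableAt
  · exact hU.tendstoUniformlyOnFilter.mono_right (le_principal_iff.2 hx)
  · filter_upwards [hf.prod_mk hx] with n hn
    exact (hn.1.differentiableAt (isOpen_ball.mem_nhds
      (ball_subset_ball (by linarith) hn.2))).hasFDerivAt
  · filter_upwards [ball_mem_nhds x hr] with y hy using hfg.tendsto_at hy

/-- Quadratic Taylor estimate for a holomorphic map on a ball. -/
theorem norm_sub_sub_fderiv_le_of_mapsTo_ball {f : E → F} {y z : E} {r M : ℝ} (hr : 0 < r)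
    (hf : DifferentiableOn ℂ f (ball y r)) (hM : MapsTo f (ball y r) (closedBall (f y) M))
    (hz : z ∈ ball y r) :
    ‖f z - f y - fderiv ℂ f y (z - y)‖ ≤ 2 * M * (‖z - y‖ / r) ^ 2 := by
  have hM0 : 0 ≤ M := nonempty_closedBall.1 ⟨_, hM hz⟩
  have hdy : DifferentiableAt ℂ f y := hf.differentiableAt (ball_mem_nhds y hr)
  have hD := Complex.norm_fderiv_le_div_of_mapsTo_ball hf hM hr
  have h := Complex.dist_le_mul_div_pow_of_mapsTo_ball_of_isLittleO (n := 1) (R₂ := 2 * M)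
    (f := fun w ↦ f w - f y - fderiv ℂ f y (w - y)) (c := y) (z := z) (R₁ := r)
    ?_ ?_ ?_ hz
  · simpa [dist_eq_norm] using h
  · exact (hf.sub_const _).sub (by fun_prop)
  · intro w hw
    have h₁ := hM hw
    have h₂ : ‖fderiv ℂ f y (w - y)‖ ≤ M / r * r :=
      (ContinuousLinearMap.le_opNorm _ _).trans
        (mul_le_mul hD (mem_ball_iff_norm.1 hw).le (norm_nonneg _) (by positivity))
    rw [div_mul_cancel₀ _ hr.ne'] at h₂
    rw [mem_closedBall, dist_eq_norm] at h₁ ⊢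
    simp only [sub_self, map_zero, sub_zero]
    exact (norm_sub_le _ _).trans (by linarith)
  · simpa using hdy.hasFDerivAt.isLittleO.norm_right

/-- Directional derivatives of a holomorphic map are holomorphic. -/
theorem DifferentiableOn.fderiv_apply_complex [CompleteSpace F] {f : E → F} {U : Set E}
    (hU : IsOpen U) (hf : DifferentiableOn ℂ f U) (v : E) :
    DifferentiableOn ℂ (fun x ↦ fderiv ℂ f x v) U := by
  intro x hx
  obtain ⟨s, hs, hsU⟩ : ∃ s > 0, ball x s ⊆ U ∩ f ⁻¹' ball (f x) 1 :=
    Metric.mem_nhds_iff.1 (inter_mem (hU.mem_nhds hx)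
      ((hf.continuousOn.continuousAt (hU.mem_nhds hx)) (ball_mem_nhds _ one_pos)))
  obtain ⟨r, hr, rfl⟩ : ∃ r > 0, s = 2 * r := ⟨s / 2, by positivity, by ring⟩
  have hball : ∀ y ∈ ball x r, ball y r ⊆ ball x (2 * r) := fun y hy ↦
    ball_subset_ball' (by have := mem_ball.1 hy; linarith)
  have hsmall : ∀ᶠ t : ℂ in 𝓝[≠] 0, ‖t • v‖ < r := by
    have : Tendsto (fun t : ℂ ↦ ‖t • v‖) (𝓝 0) (𝓝 0) := by
      have h : Continuous (fun t : ℂ ↦ ‖t • v‖) := by fun_prop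
      simpa using h.tendsto 0
    exact (this.mono_left nhdsWithin_le_nhds).eventually_lt_const hr
  have hmem : ∀ y ∈ ball x r, ∀ t : ℂ, ‖t • v‖ < r → y + t • v ∈ ball y r := fun y _ t ht ↦ by
    simpa [mem_ball_iff_norm] using ht
  refine (TendstoUniformlyOn.differentiableAt_complex (l := 𝓝[≠] (0 : ℂ)) hr
    (f := fun t y ↦ t⁻¹ • (f (y + t • v) - f y)) ?_ ?_).differentiableWithinAt
  · filter_upwards [hsmall] with t ht
    refine DifferentiableOn.const_smul (DifferentiableOn.sub ?_ ?_) _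
    · exact hf.comp (by fun_prop) fun y hy ↦ (hsU (hball y hy (hmem y hy t ht))).1
    · exact hf.mono fun y hy ↦ (hsU (hball y hy (mem_ball_self hr))).1
  · rw [Metric.tendstoUniformlyOn_iff]
    intro ε hε
    have hlim : Tendsto (fun t : ℂ ↦ 4 * ‖t‖ * (‖v‖ / r) ^ 2) (𝓝 0) (𝓝 0) := by
      have h : Continuous (fun t : ℂ ↦ 4 * ‖t‖ * (‖v‖ / r) ^ 2) := by fun_prop
      simpa using h.tendsto 0
    filter_upwards [hsmall, (hlim.mono_left nhdsWithin_le_nhds).eventually_lt_const hε,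
      self_mem_nhdsWithin] with t ht htε ht0 y hy
    have ht0' : 0 < ‖t‖ := norm_pos_iff.2 ht0
    have key := norm_sub_sub_fderiv_le_of_mapsTo_ball (M := 2) hr
      (hf.mono fun w hw ↦ (hsU (hball y hy hw)).1) (fun w hw ↦ ?_) (hmem y hy t ht)
    · have heq : f (y + t • v) - f y - fderiv ℂ f y (y + t • v - y)
          = t • (t⁻¹ • (f (y + t • v) - f y) - fderiv ℂ f y v) := by
        rw [smul_sub, smul_inv_smul₀ ht0, add_sub_cancel_left, map_smul]
      rw [heq, norm_smul, add_sub_cancel_left, norm_smul] at key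
      rw [dist_comm, dist_eq_norm]
      refine lt_of_le_of_lt (le_of_mul_le_mul_left (key.trans_eq ?_) ht0') htε
      ring
    · have h₁ := (hsU (hball y hy hw)).2
      have h₂ := (hsU (hball y hy (mem_ball_self hr))).2
      simp only [mem_preimage, mem_ball] at h₁ h₂
      rw [mem_closedBall]
      linarith [dist_triangle_right (f w) (f y) (f x)]

/-- Holomorphic maps on open subsets of finite-dimensional spaces are smooth. -/
theorem DifferentiableOn.contDiffOn_complex [FiniteDimensional ℂ E] [CompleteSpace F] {U : Set E}
    (hU : IsOpen U) (n : ℕ) {f : E → F} (hf : DifferentiableOn ℂ f U) : ContDiffOn ℂ n f U := by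
  induction n generalizing f with
  | zero => simpa using hf.continuousOn
  | succ n ih =>
    rw [Nat.cast_succ, contDiffOn_succ_iff_fderiv_of_isOpen hU]
    exact ⟨hf, by simp, contDiffOn_clm_apply.2 fun v ↦ ih (hf.fderiv_apply_complex hU v)⟩

theorem DifferentiableOn.hasStrictFDerivAt_complex [FiniteDimensional ℂ E] [CompleteSpace F]
    {U : Set E} (hU : IsOpen U) {f : E → F} (hf : DifferentiableOn ℂ f U) {x : E} (hx : x ∈ U) :
    HasStrictFDerivAt f (fderiv ℂ f x) x :=
  ((hf.contDiffOn_complex hU 1).contDiffAt (hU.mem_nhds hx)).hasStrictFDerivAt (by simp)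

end Holomorphic

/-- An injective holomorphic function of one variable has no critical points. -/
theorem Complex.deriv_ne_zero_of_injOn {f : ℂ → ℂ} {U : Set ℂ} (hU : IsOpen U)
    (hf : DifferentiableOn ℂ f U) (hinj : InjOn f U) {x : ℂ} (hx : x ∈ U) : deriv f x ≠ 0 := by
  intro hd
  have hUx := hU.mem_nhds hx
  have hfa : AnalyticAt ℂ f x := hf.analyticAt hUx
  have hnz : ¬ ∀ᶠ z in 𝓝 x, f z - f x = 0 := by
    intro h
    have h' : ∀ᶠ z in 𝓝[≠] x, z ∈ ({x}ᶜ : Set ℂ) ∧ z ∈ U ∧ f z - f x = 0 :=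
      (eventually_mem_set.2 self_mem_nhdsWithin).and
        (((eventually_mem_set.2 hUx).and h).filter_mono nhdsWithin_le_nhds)
    obtain ⟨z, hzx, hzU, hz⟩ := h'.exists
    exact hzx (hinj hzU hx (sub_eq_zero.1 hz))
  obtain ⟨n, g, hg, hgx, hfg⟩ :=
    (AnalyticAt.exists_eventuallyEq_pow_smul_nonzero_iff (hfa.sub analyticAt_const)).2 hnz
  simp only [smul_eq_mul] at hfg
  have hn0 : n ≠ 0 := by
    rintro rfl
    exact hgx (by simpa using hfg.self_of_nhds.symm)
  have hn1 : n ≠ 1 := by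
    rintro rfl
    have h₁ : HasDerivAt (fun z ↦ (z - x) ^ 1 * g z) (g x) x := by
      simpa using! ((hasDerivAt_id x).sub_const x).mul hg.differentiableAt.hasDerivAt
    have h₂ : deriv (fun z ↦ f z - f x) x = g x := (h₁.congr_of_eventuallyEq hfg).deriv
    exact hgx (by rw [← h₂, deriv_sub_const, hd])
  set k : ℂ → ℂ := fun z ↦ (z - x) * (g z / g x) ^ ((n : ℂ)⁻¹) with hk
  have hkn : ∀ z, k z ^ n * g x = (z - x) ^ n * g z := fun z ↦ by
    rw [hk, mul_pow, Complex.cpow_nat_inv_pow _ hn0]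
    field_simp
  have hkx : k x = 0 := by simp [hk]
  have hka : AnalyticAt ℂ k x := by
    refine (analyticAt_id.sub analyticAt_const).mul ((hg.div_const).cpow analyticAt_const ?_)
    simp [hgx]
  have hkd : deriv k x = 1 := by
    have h₁ : DifferentiableAt ℂ (fun z ↦ (g z / g x) ^ ((n : ℂ)⁻¹)) x :=
      ((hg.div_const).cpow analyticAt_const (by simp [hgx])).differentiableAt
    have h₂ := ((hasDerivAt_id x).sub_const x).mul h₁.hasDerivAt
    simpa [hgx] using! h₂.deriv
  have hmap : map k (𝓝 x) = 𝓝 0 := by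
    rw [← hkx]
    exact hka.hasStrictDerivAt.map_nhds_eq (by simp [hkd])
  have hV : k '' {z | z ∈ U ∧ f z - f x = (z - x) ^ n * g z} ∈ 𝓝 0 := by
    rw [← hmap]
    exact image_mem_map (Filter.inter_mem hUx hfg)
  have hζ := Complex.isPrimitiveRoot_exp n hn0
  set ζ := Complex.exp (2 * Real.pi * Complex.I / n)
  have hV' : ∀ᶠ w in 𝓝 (0 : ℂ), ζ * w ∈ k '' {z | z ∈ U ∧ f z - f x = (z - x) ^ n * g z} := by
    have : Tendsto (fun w ↦ ζ * w) (𝓝 0) (𝓝 0) := by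
      simpa using (continuous_const_mul ζ).tendsto 0
    exact this.eventually_mem hV
  obtain ⟨w, ⟨⟨z, ⟨hzU, hz⟩, hzw⟩, z', ⟨hzU', hz'⟩, hzw'⟩, hw0⟩ :=
    ((((eventually_mem_set.2 hV).and hV').filter_mono nhdsWithin_le_nhds).and
      (self_mem_nhdsWithin : {0}ᶜ ∈ 𝓝[≠] (0 : ℂ))).exists
  have heq : f z - f x = f z' - f x := by
    rw [hz, hz', ← hkn, ← hkn, hzw, hzw', mul_pow, hζ.pow_eq_one, one_mul]
  have hzz : z = z' := hinj hzU hzU' (by simpa using heq)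
  have : ζ * w = 1 * w := by rw [one_mul, ← hzw', ← hzz, hzw]
  exact hζ.ne_one (by omega) (mul_right_cancel₀ hw0 this)

section

variable {E F : Type*} [NormedAddCommGroup E] [NormedSpace ℂ E] [NormedAddCommGroup F]
  [NormedSpace ℂ F]

/-- If the differential of an injective holomorphic map in at least two variables vanishes on the
zero locus of a holomorphic function `h`, then any holomorphic function vanishing on that locus has
zero differential there. -/
theorem fderiv_eq_zero_of_injOn_of_zero_locus [FiniteDimensional ℂ E]
    (hE : 2 ≤ Module.finrank ℂ E) {f : E → F} {h g : E → ℂ} {U : Set E} (hU : IsOpen U)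
    (hf : DifferentiableOn ℂ f U) (hinj : InjOn f U) (hh : DifferentiableOn ℂ h U)
    (hfh : ∀ x ∈ U, h x = 0 → fderiv ℂ f x = 0) (hg : DifferentiableOn ℂ g U)
    (hgh : ∀ x ∈ U, h x = 0 → g x = 0) {q : E} (hq : q ∈ U) (hhq : h q = 0) :
    fderiv ℂ g q = 0 := by
  by_contra hL
  set L := fderiv ℂ g q
  obtain ⟨v, hv⟩ : ∃ v, L v = 1 := by
    obtain ⟨v, hv⟩ : ∃ v, L v ≠ 0 := by
      by_contra! hcon
      exact hL (ContinuousLinearMap.ext hcon)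
    exact ⟨(L v)⁻¹ • v, by simp [hv]⟩
  have hv0 : v ≠ 0 := by rintro rfl; simp at hv
  have hvn : 0 < ‖v‖ := norm_pos_iff.2 hv0
  obtain ⟨w, hw⟩ : ∃ w, w ∉ Submodule.span ℂ {v} := by
    by_contra! hcon
    have h₁ : Submodule.span ℂ {v} = ⊤ := Submodule.eq_top_iff'.2 hcon
    have h₂ := finrank_span_singleton (K := ℂ) hv0
    rw [h₁, finrank_top] at h₂
    omega
  -- strict differentiability of `g` at `q`
  set c : ℝ := 1 / (2 * ‖v‖) with hc
  have hc0 : 0 < c := by positivity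
  have hcv : ∀ t : ℂ, c * ‖t • v‖ = ‖t‖ / 2 := fun t ↦ by
    rw [norm_smul, hc]; field_simp
  obtain ⟨δ, hδ, hδU, hstrict⟩ : ∃ δ > 0, ball q δ ⊆ U ∧
      ∀ a ∈ ball q δ, ∀ b ∈ ball q δ, ‖g a - g b - L (a - b)‖ ≤ c * ‖a - b‖ := by
    obtain ⟨s, hs, hsc⟩ := (hg.hasStrictFDerivAt_complex hU hq).approximates_deriv_on_nhds
      (c := ⟨c, hc0.le⟩) (Or.inr hc0)
    obtain ⟨δ, hδ, hδs⟩ := Metric.mem_nhds_iff.1 (inter_mem (hU.mem_nhds hq) hs)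
    exact ⟨δ, hδ, fun x hx ↦ (hδs hx).1,
      fun a ha b hb ↦ hsc a (hδs ha).2 b (hδs hb).2⟩
  -- points of the zero locus near `q` form a Lipschitz graph over any complement of `v`
  have hgraph : ∀ x x' : E, ∀ t t' : ℂ, x + t • v ∈ ball q δ → x' + t' • v ∈ ball q δ →
      h (x + t • v) = 0 → h (x' + t' • v) = 0 → ‖t - t'‖ ≤ 2 * (‖L‖ + c) * ‖x - x'‖ := by
    intro x x' t t' hx hx' h0 h0'
    have h₁ := hstrict _ hx _ hx'
    rw [hgh _ (hδU hx) h0, hgh _ (hδU hx') h0', sub_zero, zero_sub, norm_neg,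
      show x + t • v - (x' + t' • v) = (x - x') + (t - t') • v by module, map_add, map_smul, hv,
      smul_eq_mul, mul_one] at h₁
    have h₂ : ‖t - t'‖ ≤ ‖L (x - x') + (t - t')‖ + ‖L (x - x')‖ := by
      simpa using norm_sub_le (L (x - x') + (t - t')) (L (x - x'))
    have h₃ := L.le_opNorm (x - x')
    have h₄ : c * ‖x - x' + (t - t') • v‖ ≤ c * ‖x - x'‖ + ‖t - t'‖ / 2 := by
      rw [← hcv, ← mul_add]
      exact mul_le_mul_of_nonneg_left (norm_add_le _ _) hc0.le
    linarith
  -- the zero locus meets every line parallel to `v` close to `q`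
  obtain ⟨r, hr, hrδ⟩ : ∃ r > 0, r * ‖v‖ < δ / 2 :=
    ⟨δ / (4 * ‖v‖), by positivity, by field_simp; norm_num⟩
  have hmem : ∀ s : ℂ, ‖s • w‖ < δ / 2 → ∀ t ∈ closedBall (0 : ℂ) r,
      q + s • w + t • v ∈ ball q δ := by
    intro s hs t ht
    rw [mem_closedBall_zero_iff] at ht
    rw [mem_ball_iff_norm, show q + s • w + t • v - q = s • w + t • v by module]
    refine (norm_add_le _ _).trans_lt ?_
    rw [norm_smul t]
    nlinarith
  have hsphere : ∀ t ∈ sphere (0 : ℂ) r, h (q + t • v) ≠ 0 := by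
    intro t ht h0
    have hm := hmem 0 (by simpa using hδ) t (sphere_subset_closedBall ht)
    rw [zero_smul, add_zero] at hm
    have h₁ := hgraph q q t 0 hm (by simpa using hδ) h0 (by simpa using hhq)
    have h₂ : t = 0 := by simpa using h₁
    rw [h₂, mem_sphere_zero_iff_norm, norm_zero] at ht
    exact hr.ne ht
  have hsub : Continuous fun s : ℂ ↦ ‖s • w‖ := by fun_prop
  have hline : ∀ s : ℂ, ‖s • w‖ < δ / 2 → ∀ t ∈ closedBall (0 : ℂ) r,
      ContinuousAt (fun p : ℂ × ℂ ↦ ‖h (q + p.1 • w + p.2 • v)‖) (s, t) := by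
    intro s hs t ht
    have : ContinuousAt h (q + s • w + t • v) :=
      hh.continuousOn.continuousAt (hU.mem_nhds (hδU (hmem s hs t ht)))
    exact (ContinuousAt.comp (f := fun p : ℂ × ℂ ↦ q + p.1 • w + p.2 • v) (x := (s, t)) this
      (by fun_prop)).norm
  obtain ⟨ε, hε, hεs⟩ : ∃ ε > 0, ∀ t ∈ sphere (0 : ℂ) r, ε < ‖h (q + t • v)‖ := by
    have hcont : ContinuousOn (fun t : ℂ ↦ ‖h (q + t • v)‖) (sphere 0 r) := by
      intro t ht
      have h₁ := hline 0 (by simpa using hδ) t (sphere_subset_closedBall ht)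
      have h₂ := ContinuousAt.comp (f := fun t : ℂ ↦ ((0 : ℂ), t)) (x := t) h₁ (by fun_prop)
      simpa [Function.comp_def] using h₂.continuousWithinAt
    obtain ⟨t, ht, hmin⟩ := (isCompact_sphere (0 : ℂ) r).exists_isMinOn
      (NormedSpace.sphere_nonempty.2 hr.le) hcont
    have hpos : 0 < ‖h (q + t • v)‖ := norm_pos_iff.2 (hsphere t ht)
    exact ⟨‖h (q + t • v)‖ / 2, by positivity, fun t' ht' ↦
      (half_lt_self hpos).trans_le (hmin ht')⟩
  have hsmall : ∀ᶠ s in 𝓝 (0 : ℂ), ‖s • w‖ < δ / 2 := by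
    have := hsub.tendsto 0
    rw [zero_smul, norm_zero] at this
    exact this.eventually_lt_const (by positivity)
  have hunif : ∀ᶠ s in 𝓝 (0 : ℂ), ∀ t ∈ sphere (0 : ℂ) r, ε < ‖h (q + s • w + t • v)‖ := by
    refine (isCompact_sphere (0 : ℂ) r).eventually_forall_of_forall_eventually fun t ht ↦ ?_
    refine (hline 0 (by simpa using hδ) t (sphere_subset_closedBall ht)).eventually_const_lt ?_
    simpa using hεs t ht
  have hcenter : ∀ᶠ s in 𝓝 (0 : ℂ), ‖h (q + s • w)‖ < ε := by
    have h₁ := hline 0 (by simpa using hδ) 0 (mem_closedBall_self hr.le)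
    have h₂ := ContinuousAt.comp (f := fun s : ℂ ↦ (s, (0 : ℂ))) (x := 0) h₁ (by fun_prop)
    simpa [Function.comp_def, ContinuousAt, hhq, hε] using
      h₂.eventually_lt_const (show _ < ε by simpa [hhq] using hε)
  obtain ⟨η, hη, hηs⟩ := Metric.eventually_nhds_iff_ball.1 (hsmall.and (hunif.and hcenter))
  have hexists : ∀ s ∈ ball (0 : ℂ) η, ∃ t ∈ closedBall (0 : ℂ) r, h (q + s • w + t • v) = 0 := by
    intro s hs
    obtain ⟨h₁, h₂, h₃⟩ := hηs s hs
    by_contra! hcon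
    have hd : DifferentiableOn ℂ (fun t : ℂ ↦ (h (q + s • w + t • v))⁻¹) (closedBall 0 r) := by
      refine DifferentiableOn.inv ?_ hcon
      exact hh.comp (by fun_prop) fun t ht ↦ hδU (hmem s h₁ t ht)
    have h₄ : ‖(h (q + s • w + (0 : ℂ) • v))⁻¹‖ ≤ ε⁻¹ :=
      Complex.norm_le_of_forall_mem_frontier_norm_le (U := ball (0 : ℂ) r) isBounded_ball
        (hd.diffContOnCl_ball subset_rfl)
        (fun t ht ↦ by
          rw [frontier_ball _ hr.ne'] at ht
          rw [norm_inv]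
          exact inv_anti₀ hε (h₂ t ht).le)
        (subset_closure (mem_ball_self hr))
    have h₅ := hcon 0 (mem_closedBall_self hr.le)
    rw [norm_inv, inv_le_inv₀ (norm_pos_iff.2 h₅) hε] at h₄
    simp only [zero_smul, add_zero] at h₄
    exact absurd h₃ h₄.not_gt
  choose! ζ hζr hζ using hexists
  have hηδ : ∀ s ∈ ball (0 : ℂ) η, q + s • w + ζ s • v ∈ ball q δ := fun s hs ↦
    hmem s (hηs s hs).1 _ (hζr s hs)
  -- `f` is constant along the curve `γ` in the zero locus
  set γ : ℂ → E := fun s ↦ q + s • w + ζ s • v with hγ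
  obtain ⟨C, hC⟩ : ∃ C : ℝ, ∀ s ∈ ball (0 : ℂ) η, ∀ s' ∈ ball (0 : ℂ) η,
      ‖γ s - γ s'‖ ≤ C * ‖s - s'‖ := by
    refine ⟨‖w‖ + 2 * (‖L‖ + c) * ‖w‖ * ‖v‖, fun s hs s' hs' ↦ ?_⟩
    have h₁ := hgraph _ _ _ _ (hηδ s hs) (hηδ s' hs') (hζ s hs) (hζ s' hs')
    rw [show q + s • w - (q + s' • w) = (s - s') • w by module, norm_smul] at h₁
    rw [show γ s - γ s' = (s - s') • w + (ζ s - ζ s') • v by simp only [hγ]; module]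
    refine (norm_add_le _ _).trans ?_
    rw [norm_smul, norm_smul]
    nlinarith [mul_le_mul_of_nonneg_right h₁ hvn.le]
  have hderiv : ∀ s ∈ ball (0 : ℂ) η, HasDerivAt (f ∘ γ) 0 s := by
    intro s hs
    have hsn : ball (0 : ℂ) η ∈ 𝓝 s := isOpen_ball.mem_nhds hs
    have hO : (fun s' ↦ γ s' - γ s) =O[𝓝 s] fun s' ↦ s' - s :=
      Asymptotics.IsBigO.of_bound C (by filter_upwards [hsn] with s' hs' using hC s' hs' s hs)
    have hcont : Tendsto γ (𝓝 s) (𝓝 (γ s)) := by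
      rw [tendsto_iff_norm_sub_tendsto_zero, ← tendsto_zero_iff_norm_tendsto_zero]
      refine hO.trans_tendsto ?_
      have : Continuous fun s' : ℂ ↦ s' - s := by fun_prop
      simpa using this.tendsto s
    have hUs := hδU (hηδ s hs)
    have h₁ := (hf.differentiableAt (hU.mem_nhds hUs)).hasFDerivAt
    rw [hfh _ hUs (hζ s hs)] at h₁
    rw [hasDerivAt_iff_isLittleO]
    have h₂ := (h₁.isLittleO.comp_tendsto hcont).trans_isBigO hO
    simpa [Function.comp_def] using h₂
  have hconst : (f ∘ γ) 0 = (f ∘ γ) ((η / 2 : ℝ) : ℂ) :=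
    isOpen_ball.is_const_of_deriv_eq_zero (convex_ball (0 : ℂ) η).isPreconnected
      (fun s hs ↦ (hderiv s hs).differentiableAt.differentiableWithinAt)
      (fun s hs ↦ (hderiv s hs).deriv) (mem_ball_self hη)
      (by simp [abs_of_pos hη, hη])
  have h0 : (0 : ℂ) ∈ ball (0 : ℂ) η := mem_ball_self hη
  have h1 : ((η / 2 : ℝ) : ℂ) ∈ ball (0 : ℂ) η := by simp [abs_of_pos hη, hη]
  have hγeq : γ 0 = γ ((η / 2 : ℝ) : ℂ) := hinj (hδU (hηδ _ h0)) (hδU (hηδ _ h1)) hconst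
  apply hw
  have hη2 : ((η / 2 : ℝ) : ℂ) ≠ 0 := by exact_mod_cast (half_pos hη).ne'
  generalize ((η / 2 : ℝ) : ℂ) = s at hγeq hη2
  rw [Submodule.mem_span_singleton]
  refine ⟨s⁻¹ * (ζ 0 - ζ s), ?_⟩
  have h₁ : s • w = (ζ 0 - ζ s) • v := by
    rw [← sub_eq_zero, show s • w - (ζ 0 - ζ s) • v = γ s - γ 0 by simp only [hγ]; module, hγeq,
      sub_self]
  rw [mul_smul, ← h₁, inv_smul_smul₀ hη2]

end

section

/-- A holomorphic function on a ball all of whose iterated directional derivatives at the center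
vanish is zero. -/
theorem eq_zero_of_iterate_fderiv_apply_eq_zero {E : Type*} [NormedAddCommGroup E]
    [NormedSpace ℂ E] {h : E → ℂ} {q : E} {r : ℝ} (hh : DifferentiableOn ℂ h (ball q r))
    (h0 : ∀ (v : E) (n : ℕ), (fun k : E → ℂ ↦ fun x ↦ fderiv ℂ k x v)^[n] h q = 0)
    {x : E} (hx : x ∈ ball q r) : h x = 0 := by
  set v := x - q with hv
  set D : (E → ℂ) → E → ℂ := fun k x ↦ fderiv ℂ k x v with hD
  have hDh : ∀ n, DifferentiableOn ℂ (D^[n] h) (ball q r) := by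
    intro n
    induction n with
    | zero => exact hh
    | succ n ih =>
      rw [Function.iterate_succ_apply']
      exact ih.fderiv_apply_complex isOpen_ball v
  rcases eq_or_ne v 0 with hv0 | hv0
  · rw [sub_eq_zero.1 hv0]; exact h0 v 0
  have hvn : 0 < ‖v‖ := norm_pos_iff.2 hv0
  have hmaps : MapsTo (fun t : ℂ ↦ q + t • v) (ball 0 (r / ‖v‖)) (ball q r) := fun t ht ↦ by
    rw [mem_ball_zero_iff, lt_div_iff₀ hvn] at ht
    simpa [mem_ball_iff_norm, norm_smul] using ht
  have hder : ∀ n, ∀ t ∈ ball (0 : ℂ) (r / ‖v‖),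
      HasDerivAt (fun t : ℂ ↦ D^[n] h (q + t • v)) (D^[n + 1] h (q + t • v)) t := by
    intro n t ht
    rw [Function.iterate_succ_apply']
    have h₁ := ((hDh n).differentiableAt (isOpen_ball.mem_nhds (hmaps ht))).hasFDerivAt
    have h₂ : HasDerivAt (fun t : ℂ ↦ q + t • v) v t := by
      simpa using ((hasDerivAt_id t).smul_const v).const_add q
    exact h₁.comp_hasDerivAt t h₂
  have hiter : ∀ n, EqOn (iteratedDeriv n fun t : ℂ ↦ h (q + t • v))
      (fun t ↦ D^[n] h (q + t • v)) (ball 0 (r / ‖v‖)) := by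
    intro n
    induction n with
    | zero => intro t _; simp
    | succ n ih =>
      intro t ht
      rw [iteratedDeriv_succ]
      exact (ih.eventuallyEq_of_mem (isOpen_ball.mem_nhds ht)).deriv_eq.trans (hder n t ht).deriv
  have h1 : (1 : ℂ) ∈ ball (0 : ℂ) (r / ‖v‖) := by
    rw [mem_ball_zero_iff, norm_one, lt_div_iff₀ hvn, one_mul]
    exact mem_ball_iff_norm.1 hx
  have hr : 0 < r / ‖v‖ := nonempty_ball.1 ⟨_, h1⟩
  have h₃ := Complex.taylorSeries_eq_on_ball' h1
    (fun t ht ↦ (hder 0 t ht).differentiableAt.differentiableWithinAt)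
  have h₄ : ∀ n, iteratedDeriv n (fun t : ℂ ↦ h (q + t • v)) 0 = 0 := fun n ↦ by
    rw [hiter n (mem_ball_self hr)]
    simpa using h0 v n
  simp only [Function.iterate_zero, id_eq, h₄, mul_zero, zero_mul, tsum_zero] at h₃
  rw [one_smul, hv, add_sub_cancel] at h₃
  exact h₃.symm

variable {E F : Type*} [NormedAddCommGroup E] [NormedSpace ℂ E] [NormedAddCommGroup F]
  [NormedSpace ℂ F]

/-- In at least two variables, the differential of an injective holomorphic map cannot vanish on a
nonempty zero locus of a holomorphic function. -/
theorem ne_zero_of_injOn_of_fderiv_eq_zero [FiniteDimensional ℂ E] [CompleteSpace F]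
    (hE : 2 ≤ Module.finrank ℂ E) {f : E → F} {h : E → ℂ} {U : Set E} (hU : IsOpen U)
    (hf : DifferentiableOn ℂ f U) (hinj : InjOn f U) (hh : DifferentiableOn ℂ h U)
    (hfh : ∀ x ∈ U, h x = 0 → fderiv ℂ f x = 0) {q : E} (hq : q ∈ U) : h q ≠ 0 := by
  intro hhq
  obtain ⟨r, hr, hrU⟩ := Metric.mem_nhds_iff.1 (hU.mem_nhds hq)
  have hD : ∀ (v : E) (n : ℕ),
      DifferentiableOn ℂ ((fun k : E → ℂ ↦ fun x ↦ fderiv ℂ k x v)^[n] h) U ∧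
      ∀ x ∈ U, h x = 0 → (fun k : E → ℂ ↦ fun x ↦ fderiv ℂ k x v)^[n] h x = 0 := by
    intro v n
    induction n with
    | zero => exact ⟨hh, fun _ _ h ↦ h⟩
    | succ n ih =>
      rw [Function.iterate_succ_apply']
      refine ⟨ih.1.fderiv_apply_complex hU v, fun x hx hx0 ↦ ?_⟩
      rw [fderiv_eq_zero_of_injOn_of_zero_locus hE hU hf hinj hh hfh ih.1 ih.2 hx hx0]
      rfl
  have hzero : ∀ x ∈ ball q r, h x = 0 := fun x hx ↦
    eq_zero_of_iterate_fderiv_apply_eq_zero (hh.mono hrU) (fun v n ↦ (hD v n).2 q hq hhq) hx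
  have hconst : ∀ x ∈ ball q r, f x = f q := fun x hx ↦
    isOpen_ball.is_const_of_fderiv_eq_zero (𝕜 := ℂ) (convex_ball q r).isPreconnected
      (hf.mono hrU) (fun y hy ↦ hfh y (hrU hy) (hzero y hy)) hx (mem_ball_self hr)
  have : Nontrivial E := Module.nontrivial_of_finrank_pos (R := ℂ) (by omega)
  obtain ⟨v, hv⟩ := exists_ne (0 : E)
  have hvn : 0 < ‖v‖ := norm_pos_iff.2 hv
  have hmem : q + ((r / (2 * ‖v‖) : ℝ) : ℂ) • v ∈ ball q r := by
    rw [mem_ball_iff_norm, add_sub_cancel_left, norm_smul, Complex.norm_real, Real.norm_of_nonneg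
      (by positivity)]
    field_simp
    norm_num
  have heq := hinj (hrU hmem) hq (hconst _ hmem)
  rw [add_eq_left, smul_eq_zero] at heq
  rcases heq with h₁ | h₁
  · have : r / (2 * ‖v‖) = 0 := by exact_mod_cast h₁
    exact absurd this (by positivity)
  · exact hv h₁

/-- The Jacobian determinant of a holomorphic map is holomorphic. -/
theorem DifferentiableOn.det_fderiv_complex [FiniteDimensional ℂ E] {f : E → E} {U : Set E}
    (hU : IsOpen U) (hf : DifferentiableOn ℂ f U) :
    DifferentiableOn ℂ (fun x ↦ LinearMap.det (fderiv ℂ f x : E →ₗ[ℂ] E)) U := by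
  have : CompleteSpace E := FiniteDimensional.complete ℂ E
  let b := Module.finBasis ℂ E
  simp_rw [← LinearMap.det_toMatrix b, Matrix.det_apply]
  refine DifferentiableOn.fun_sum fun σ _ ↦ DifferentiableOn.const_smul ?_ _
  have hentry (i) : DifferentiableOn ℂ
      (fun x ↦ LinearMap.toMatrix b b (fderiv ℂ f x : E →ₗ[ℂ] E) (σ i) i) U := by
    simp_rw [LinearMap.toMatrix_apply]
    exact (LinearMap.toContinuousLinearMap (b.coord (σ i))).differentiable.comp_differentiableOn
      (hf.fderiv_apply_complex hU (b i))
  exact fun x hx ↦ (HasFDerivWithinAt.finsetProd fun i _ ↦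
    (hentry i x hx).hasFDerivWithinAt).differentiableWithinAt

end

section

universe u v

/-- The holomorphic inverse function theorem, with a local inverse that is holomorphic on an open
set. -/
theorem DifferentiableOn.exists_local_inverse_complex {E F : Type*} [NormedAddCommGroup E]
    [NormedSpace ℂ E] [NormedAddCommGroup F] [NormedSpace ℂ F] [FiniteDimensional ℂ E]
    [CompleteSpace F] {f : E → F} {U : Set E} {p : E} (hU : IsOpen U)
    (hf : DifferentiableOn ℂ f U) (hp : p ∈ U) {e : E ≃L[ℂ] F} (he : fderiv ℂ f p = e) :
    ∃ (O : Set F) (g : F → E), IsOpen O ∧ f p ∈ O ∧ DifferentiableOn ℂ g O ∧ MapsTo g O U ∧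
      (∀ y ∈ O, f (g y) = y) ∧ g (f p) = p ∧ HasFDerivAt g (e.symm : F →L[ℂ] E) (f p) := by
  have : CompleteSpace E := FiniteDimensional.complete ℂ E
  have hc : ContDiffAt ℂ ((1 : ℕ) : WithTop ℕ∞) f p :=
    (hf.contDiffOn_complex hU 1).contDiffAt (hU.mem_nhds hp)
  have hd : HasFDerivAt f (e : E →L[ℂ] F) p :=
    he ▸ (hf.differentiableAt (hU.mem_nhds hp)).hasFDerivAt
  have hn : ((1 : ℕ) : WithTop ℕ∞) ≠ 0 := by simp
  have hs := hc.hasStrictFDerivAt' hd hn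
  set g := hc.localInverse hd hn with hg
  have hgp : g (f p) = p := hc.localInverse_apply_image hd hn
  have h₁ : ∀ᶠ y in 𝓝 (f p), f (g y) = y := hs.eventually_right_inverse
  have h₂ : ∀ᶠ y in 𝓝 (f p), DifferentiableAt ℂ g y :=
    ((hc.to_localInverse hd hn).eventually (by simp)).mono fun y hy ↦ hy.differentiableAt hn
  have h₃ : ∀ᶠ y in 𝓝 (f p), g y ∈ U :=
    hs.localInverse_continuousAt.eventually_mem (by
      change U ∈ 𝓝 (g (f p)); rw [hgp]; exact hU.mem_nhds hp)
  obtain ⟨O, hO, hOo, hpO⟩ := _root_.eventually_nhds_iff.1 ((h₁.and h₂).and h₃)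
  exact ⟨O, g, hOo, hpO, fun y hy ↦ (hO y hy).1.2.differentiableWithinAt, fun y hy ↦ (hO y hy).2,
    fun y hy ↦ (hO y hy).1.1, hgp, hs.to_localInverse.hasFDerivAt⟩

/-- If injective holomorphic maps in dimension `n` are immersions, then an injective holomorphic
map in dimension `n + 1` is an immersion wherever its differential does not vanish. -/
theorem injective_fderiv_of_ne_zero_of_injOn {n : ℕ}
    (ih : ∀ (E : Type u) [NormedAddCommGroup E] [NormedSpace ℂ E] [FiniteDimensional ℂ E]
      (F : Type v) [NormedAddCommGroup F] [NormedSpace ℂ F] [FiniteDimensional ℂ F],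
      Module.finrank ℂ E = n → Module.finrank ℂ F = n → ∀ (f : E → F) (U : Set E), IsOpen U →
      DifferentiableOn ℂ f U → InjOn f U → ∀ x ∈ U, Function.Injective (fderiv ℂ f x))
    {E : Type u} [NormedAddCommGroup E] [NormedSpace ℂ E] [FiniteDimensional ℂ E]
    {F : Type v} [NormedAddCommGroup F] [NormedSpace ℂ F] [FiniteDimensional ℂ F]
    (hE : Module.finrank ℂ E = n + 1) (hF : Module.finrank ℂ F = n + 1) {f : E → F} {U : Set E}
    (hU : IsOpen U) (hf : DifferentiableOn ℂ f U) (hinj : InjOn f U) {p : E} (hp : p ∈ U)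
    (hA : fderiv ℂ f p ≠ 0) : Function.Injective (fderiv ℂ f p) := by
  have : CompleteSpace E := FiniteDimensional.complete ℂ E
  set A := fderiv ℂ f p
  have hfA : HasFDerivAt f A p := (hf.differentiableAt (hU.mem_nhds hp)).hasFDerivAt
  obtain ⟨v, hv⟩ : ∃ v, A v ≠ 0 := by
    by_contra! h
    exact hA (ContinuousLinearMap.ext h)
  obtain ⟨l, hl⟩ := SeparatingDual.exists_eq_one (R := ℂ) hv
  set Φ : E → E := fun x ↦ x + (l (f x) - l (f p) - l (A (x - p))) • v with hΦ
  have hΦp : Φ p = p := by simp [hΦ]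
  have hAd : Differentiable ℂ fun x ↦ l (A (x - p)) :=
    (l.comp A).differentiable.comp (differentiable_id.sub_const p)
  have hΦd : DifferentiableOn ℂ Φ U :=
    differentiableOn_id.add ((((l.differentiable.comp_differentiableOn hf).sub_const _).sub
      hAd.differentiableOn).smul_const v)
  have hΦder : HasFDerivAt Φ ((ContinuousLinearEquiv.refl ℂ E : E ≃L[ℂ] E) : E →L[ℂ] E) p := by
    have h₁ : HasFDerivAt (fun x ↦ l (f x) - l (f p)) (l.comp A) p :=
      (l.hasFDerivAt.comp p hfA).sub_const _
    have h₂ : HasFDerivAt (fun x ↦ l (A (x - p))) (l.comp A) p :=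
      (l.comp A).hasFDerivAt.comp p ((hasFDerivAt_id p).sub_const p)
    refine ((hasFDerivAt_id p).add ((h₁.sub h₂).smul_const v)).congr_fderiv ?_
    ext x
    simp
  obtain ⟨O, g, hO, hpO, hgd, hgU, hgr, hgp, hgder⟩ :=
    hΦd.exists_local_inverse_complex hU hp hΦder.fderiv
  rw [hΦp] at hpO hgp hgder
  have hlA (x : E) : l (A (Φ x)) = l (f x) - l (f p) + l (A p) := by
    simp only [hΦ, map_add, map_smul, map_sub, hl, smul_eq_mul, mul_one]
    ring
  set K := (l.comp A : E →ₗ[ℂ] ℂ).ker with hK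
  set M := (l : F →ₗ[ℂ] ℂ).ker with hM
  set Q : F →L[ℂ] M := (ContinuousLinearMap.id ℂ F - l.smulRight (A v)).codRestrict M
    (fun y ↦ by simp [hM, hl])
  have hQval (y : F) : (Q y : F) = y - l y • A v := rfl
  set ψ : K → M := fun k ↦ Q (f (g (p + k))) with hψ
  have hadd : Differentiable ℂ fun k : K ↦ p + (k : E) :=
    K.subtypeL.differentiable.const_add p
  set W : Set K := (fun k : K ↦ p + (k : E)) ⁻¹' O with hW
  have hWo : IsOpen W := hO.preimage hadd.continuous
  have h0W : (0 : K) ∈ W := by simpa [hW] using hpO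
  have hψd : DifferentiableOn ℂ ψ W :=
    Q.differentiable.comp_differentiableOn
      ((hf.comp hgd hgU).comp hadd.differentiableOn fun _ h ↦ h)
  have hψinj : InjOn ψ W := by
    intro k₁ hk₁ k₂ hk₂ heq
    have hval (k : K) (hk : k ∈ W) : l (f (g (p + k))) = l (f p) := by
      have h₁ := hlA (g (p + k))
      have h₂ : l (A k) = 0 := k.2
      rw [hgr _ hk, map_add, map_add, h₂] at h₁
      linear_combination -h₁
    have h₁ := congrArg (Subtype.val : M → F) heq
    simp only [hψ, hQval, hval k₁ hk₁, hval k₂ hk₂, sub_left_inj] at h₁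
    have h₂ := congrArg Φ (hinj (hgU hk₁) (hgU hk₂) h₁)
    rw [hgr _ hk₁, hgr _ hk₂, add_right_inj] at h₂
    exact Subtype.ext h₂
  have hψder : HasFDerivAt ψ (Q.comp (A.comp K.subtypeL)) 0 := by
    have h₁ : HasFDerivAt (fun k : K ↦ p + (k : E)) K.subtypeL 0 := by
      simpa using K.subtypeL.hasFDerivAt.const_add p
    have h₂ : HasFDerivAt (fun k : K ↦ g (p + (k : E))) K.subtypeL 0 :=
      HasFDerivAt.comp (g' := ContinuousLinearMap.id ℂ E) (0 : K) (by simpa using hgder) h₁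
    have h₃ : HasFDerivAt (fun k : K ↦ f (g (p + (k : E)))) (A.comp K.subtypeL) 0 :=
      HasFDerivAt.comp (g' := A) (0 : K) (by simpa [hgp] using hfA) h₂
    exact Q.hasFDerivAt.comp (0 : K) h₃
  have hlA0 : (l.comp A : E →ₗ[ℂ] ℂ) ≠ 0 := fun h ↦ by
    have := LinearMap.congr_fun h v
    simp [hl] at this
  have hl0 : (l : F →ₗ[ℂ] ℂ) ≠ 0 := fun h ↦ by
    have := LinearMap.congr_fun h (A v)
    simp [hl] at this
  have hKn : Module.finrank ℂ K = n := by
    have h : Module.finrank ℂ K + 1 = Module.finrank ℂ E :=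
      Module.Dual.finrank_ker_add_one_of_ne_zero hlA0
    omega
  have hMn : Module.finrank ℂ M = n := by
    have h : Module.finrank ℂ M + 1 = Module.finrank ℂ F :=
      Module.Dual.finrank_ker_add_one_of_ne_zero hl0
    omega
  have hmain := ih K M hKn hMn ψ W hWo hψd hψinj 0 h0W
  rw [hψder.fderiv] at hmain
  refine (injective_iff_map_eq_zero A).2 fun x hx ↦ ?_
  have hxK : x ∈ K := by
    change l (A x) = 0
    rw [hx, map_zero]
  have h₁ := (injective_iff_map_eq_zero _).1 hmain ⟨x, hxK⟩ (by simp [hx])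
  exact congrArg Subtype.val h₁

/-- **Osgood's theorem**: an injective holomorphic map between spaces of the same finite dimension
has injective differential at every point. -/
theorem injective_fderiv_of_injOn_of_finrank_eq (n : ℕ) :
    ∀ (E : Type u) [NormedAddCommGroup E] [NormedSpace ℂ E] [FiniteDimensional ℂ E]
      (F : Type v) [NormedAddCommGroup F] [NormedSpace ℂ F] [FiniteDimensional ℂ F],
      Module.finrank ℂ E = n → Module.finrank ℂ F = n → ∀ (f : E → F) (U : Set E), IsOpen U →
      DifferentiableOn ℂ f U → InjOn f U → ∀ x ∈ U, Function.Injective (fderiv ℂ f x) := by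
  induction n with
  | zero =>
    intro E _ _ _ F _ _ _ hE _ f U _ _ _ x _
    have := Module.finrank_zero_iff.1 hE
    exact Function.injective_of_subsingleton _
  | succ n ih =>
    intro E _ _ _ F _ _ _ hE hF f U hU hf hinj p hp
    have : CompleteSpace F := FiniteDimensional.complete ℂ F
    refine injective_fderiv_of_ne_zero_of_injOn ih hE hF hU hf hinj hp fun h0 ↦ ?_
    rcases Nat.eq_zero_or_pos n with rfl | hn
    · let a : ℂ ≃L[ℂ] E := .ofFinrankEq (by rw [hE, Module.finrank_self])
      let b : F ≃L[ℂ] ℂ := .ofFinrankEq (by rw [hF, Module.finrank_self])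
      have hpa : a.symm p ∈ a ⁻¹' U := by simpa using hp
      refine Complex.deriv_ne_zero_of_injOn (f := b ∘ f ∘ a) (hU.preimage a.continuous)
        (b.differentiable.comp_differentiableOn
          (hf.comp a.differentiable.differentiableOn fun _ h ↦ h))
        (b.injective.comp_injOn (hinj.comp a.injective.injOn fun _ h ↦ h)) hpa ?_
      have h₁ : HasFDerivAt f (0 : E →L[ℂ] F) (a (a.symm p)) := by
        rw [a.apply_symm_apply, ← h0]
        exact (hf.differentiableAt (hU.mem_nhds hp)).hasFDerivAt
      have h₂ := b.hasFDerivAt.comp _ (h₁.comp _ a.hasFDerivAt)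
      rw [h₂.hasDerivAt.deriv]
      simp
    · let e : F ≃L[ℂ] E := .ofFinrankEq (hF.trans hE.symm)
      have hed : DifferentiableOn ℂ (e ∘ f) U := e.differentiable.comp_differentiableOn hf
      have hefd (x : E) : fderiv ℂ (e ∘ f) x = (e : F →L[ℂ] E).comp (fderiv ℂ f x) :=
        e.comp_fderiv
      refine ne_zero_of_injOn_of_fderiv_eq_zero (by omega) hU hf hinj
        (hed.det_fderiv_complex hU) (fun x hx hx0 ↦ ?_) hp ?_
      · by_contra hne
        have hxinj := injective_fderiv_of_ne_zero_of_injOn ih hE hF hU hf hinj hx hne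
        refine LinearMap.det_eq_zero_iff_ker_ne_bot.1 hx0 (LinearMap.ker_eq_bot.2 ?_)
        rw [hefd]
        exact e.injective.comp hxinj
      · rw [hefd, h0, LinearMap.det_eq_zero_iff_ker_ne_bot, ContinuousLinearMap.comp_zero]
        have : Nontrivial E := Module.nontrivial_of_finrank_pos (R := ℂ) (by omega)
        simp

end

section

/-- The inverse of a holomorphic bijection of an open set onto itself is holomorphic. -/
theorem DifferentiableOn.invFunOn_complex {E : Type*} [NormedAddCommGroup E] [NormedSpace ℂ E]
    [FiniteDimensional ℂ E] {f : E → E} {U V : Set E} (hU : IsOpen U)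
    (hf : DifferentiableOn ℂ f U) (hbij : BijOn f U V) :
    DifferentiableOn ℂ (Function.invFunOn f U) V := by
  have : CompleteSpace E := FiniteDimensional.complete ℂ E
  intro y hy
  obtain ⟨x, hx, rfl⟩ := hbij.surjOn hy
  have hinj : Function.Injective (fderiv ℂ f x) :=
    injective_fderiv_of_injOn_of_finrank_eq _ E E rfl rfl f U hU hf hbij.injOn x hx
  let e : E ≃L[ℂ] E :=
    (LinearEquiv.ofInjectiveEndo (fderiv ℂ f x : E →ₗ[ℂ] E) hinj).toContinuousLinearEquiv
  obtain ⟨O, g, hO, hxO, hgd, hgU, hgr, -, -⟩ :=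
    hf.exists_local_inverse_complex hU hx (e := e) (by ext; rfl)
  have heq : EqOn (Function.invFunOn f U) g O := fun z hz ↦ by
    have h := hbij.injOn.leftInvOn_invFunOn (hgU hz)
    rwa [hgr z hz] at h
  exact ((hgd.congr heq).differentiableAt (hO.mem_nhds hxO)).differentiableWithinAt

variable {E F : Type*} [NormedAddCommGroup E] [NormedSpace ℂ E] [NormedAddCommGroup F]
  [NormedSpace ℂ F]

/-- A limit, in the compact-open topology, of holomorphic maps is holomorphic. -/
theorem DifferentiableOn.of_tendsto_continuousMap [ProperSpace E] [CompleteSpace F] {U : Set E}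
    (hU : IsOpen U) {ι : Type*} {l : Filter ι} [l.NeBot] {k : ι → C(U, F)} {k₀ : C(U, F)}
    (hk : Tendsto k l (𝓝 k₀)) {φ : ι → E → F} {φ₀ : E → F}
    (hφ : ∀ i, DifferentiableOn ℂ (φ i) U) (hφk : ∀ i (z : U), k i z = φ i z)
    (hφk₀ : ∀ z : U, k₀ z = φ₀ z) : DifferentiableOn ℂ φ₀ U := by
  intro x hx
  obtain ⟨r, hr, hrU⟩ := Metric.nhds_basis_closedBall.mem_iff.1 (hU.mem_nhds hx)
  have hK : IsCompact ((↑) ⁻¹' closedBall x r : Set U) := by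
    rw [Subtype.isCompact_iff, Subtype.image_preimage_coe, inter_eq_right.2 hrU]
    exact isCompact_closedBall x r
  have hunif := ContinuousMap.tendsto_iff_forall_isCompact_tendstoUniformlyOn.1 hk _ hK
  refine (TendstoUniformlyOn.differentiableAt_complex (f := φ) (l := l) hr
    (.of_forall fun i ↦ (hφ i).mono (ball_subset_closedBall.trans hrU))
    fun u hu ↦ ?_).differentiableWithinAt
  filter_upwards [hunif u hu] with i hi y hy
  have hyc := ball_subset_closedBall hy
  simpa [hφk, hφk₀] using hi ⟨y, hrU hyc⟩ hyc

/-- Holomorphic maps into a bounded set form an equicontinuous family. -/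
theorem equicontinuous_of_mapsTo_isBounded {U : Set E} {V : Set F} (hU : IsOpen U)
    (hV : Bornology.IsBounded V) {ι : Type*} {k : ι → U → F} {φ : ι → E → F}
    (hφ : ∀ i, DifferentiableOn ℂ (φ i) U) (hmaps : ∀ i, MapsTo (φ i) U V)
    (hφk : ∀ i (z : U), k i z = φ i z) : Equicontinuous k := by
  rintro ⟨x, hx⟩
  obtain ⟨r, hr, hrU⟩ := Metric.mem_nhds_iff.1 (hU.mem_nhds hx)
  refine Metric.equicontinuousAt_of_continuity_modulus
    (fun z : U ↦ diam V / r * dist (z : E) x) ?_ k ?_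
  · have : Continuous fun z : U ↦ diam V / r * dist (z : E) x := by fun_prop
    simpa using this.tendsto ⟨x, hx⟩
  · filter_upwards [continuous_subtype_val.continuousAt.preimage_mem_nhds (ball_mem_nhds x hr)]
      with z hz i
    rw [hφk, hφk, dist_comm]
    exact Complex.dist_le_div_mul_dist_of_mapsTo_ball ((hφ i).mono hrU)
      (fun y hy ↦ dist_le_diam_of_mem hV (hmaps i (hrU hy)) (hmaps i hx)) hz

/-- **Montel's theorem** for maps into a bounded set. -/
theorem isCompact_closure_of_mapsTo_isBounded [ProperSpace E] [ProperSpace F] {U : Set E}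
    {V : Set F} (hU : IsOpen U) (hV : Bornology.IsBounded V) {S : Set C(U, F)}
    (hS : ∀ k ∈ S, ∃ φ : E → F, DifferentiableOn ℂ φ U ∧ MapsTo φ U V ∧ ∀ z : U, k z = φ z) :
    IsCompact (closure S) := by
  have : LocallyCompactSpace U := hU.locallyCompactSpace
  choose φ hφ hmaps hφk using fun k : S ↦ hS k k.2
  have hequi : Equicontinuous fun k : S ↦ ((k : C(U, F)) : U → F) :=
    equicontinuous_of_mapsTo_isBounded hU hV hφ hmaps hφk
  refine ArzelaAscoli.isCompact_closure_of_isClosedEmbedding (𝔖 := {K : Set U | IsCompact K})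
    (F := fun k : C(U, F) ↦ (k : U → F)) (fun _ h ↦ h)
    ⟨ContinuousMap.isUniformEmbedding_toUniformOnFunIsCompact.isEmbedding, ?_⟩
    (fun K _ ↦ hequi.equicontinuousOn K)
    fun K _ x _ ↦ ⟨closure V, hV.isCompact_closure, fun k hk ↦ ?_⟩
  · change IsClosed (range ContinuousMap.toUniformOnFunIsCompact)
    rw [ContinuousMap.range_toUniformOnFunIsCompact]
    exact UniformOnFun.isClosed_setOfPred_continuous CompactlyCoherentSpace.isCoherentWith
  · rw [hφk ⟨k, hk⟩ x]
    exact subset_closure (hmaps _ x.2)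

end

section Automorphisms

variable {n : ℕ} {Ω : Set (Fin n → ℂ)}

theorem AutRestrictions.apply_mem {f : C(Ω, Fin n → ℂ)} (hf : f ∈ AutRestrictions n Ω) (z : Ω) :
    f z ∈ Ω := by
  obtain ⟨φ, -, hφ, hfφ⟩ := hf
  exact hfφ z ▸ hφ.mapsTo z.2

theorem AutRestrictions.exists_inverse (hΩ : IsOpen Ω) {f : C(Ω, Fin n → ℂ)}
    (hf : f ∈ AutRestrictions n Ω) :
    ∃ g ∈ AutRestrictions n Ω, ∀ z w : Ω, f z = w ↔ g w = z := by
  obtain ⟨φ, hφd, hφ, hfφ⟩ := hf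
  have hd := hφd.invFunOn_complex hΩ hφ
  have hinv := hφ.invOn_invFunOn
  refine ⟨⟨fun z ↦ Function.invFunOn φ Ω z, hd.continuousOn.domRestrict⟩,
    ⟨_, hd, hinv.symm.bijOn hφ.surjOn.mapsTo_invFunOn hφ.mapsTo, fun _ ↦ rfl⟩, fun z w ↦ ?_⟩
  rw [hfφ]
  change φ z = w ↔ Function.invFunOn φ Ω w = z
  exact ⟨fun h ↦ h ▸ hinv.1 z.2, fun h ↦ h ▸ hinv.2 w.2⟩

/-- If the orbits of the automorphism group have no accumulation point on the boundary, then the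
limits of automorphisms take their values in the domain. -/
theorem AutRestrictions.apply_mem_of_tendsto {ι : Type*} {l : Filter ι} [l.NeBot]
    (hΩ : IsOpen Ω)
    (horbit : ¬ ∃ P ∈ Ω, ∃ X ∈ frontier Ω, ∃ φ : ℕ → (Fin n → ℂ) → (Fin n → ℂ),
      (∀ j, DifferentiableOn ℂ (φ j) Ω ∧ BijOn (φ j) Ω Ω) ∧
      Tendsto (fun j ↦ φ j P) atTop (𝓝 X))
    {k : ι → C(Ω, Fin n → ℂ)} {k₀ : C(Ω, Fin n → ℂ)} (hk : ∀ i, k i ∈ AutRestrictions n Ω)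
    (hlim : Tendsto k l (𝓝 k₀)) (z : Ω) : k₀ z ∈ Ω := by
  have hz : Tendsto (fun i ↦ k i z) l (𝓝 (k₀ z)) := hlim.eval_const z
  by_contra hnot
  have hcl : k₀ z ∈ closure ((fun f : C(Ω, Fin n → ℂ) ↦ f z) '' AutRestrictions n Ω) :=
    mem_closure_of_tendsto hz (.of_forall fun i ↦ mem_image_of_mem _ (hk i))
  obtain ⟨y, hy, hylim⟩ := mem_closure_iff_seq_limit.1 hcl
  choose f hf hfy using hy
  choose φ hφd hφ hfφ using hf
  refine horbit ⟨z, z.2, k₀ z, ?_, φ, fun j ↦ ⟨hφd j, hφ j⟩, ?_⟩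
  · rw [hΩ.frontier_eq]
    exact ⟨mem_closure_of_tendsto hz (.of_forall fun i ↦ apply_mem (hk i) z), hnot⟩
  · refine hylim.congr fun j ↦ ?_
    rw [← hfy]
    exact hfφ j z

/-- Inverse pairs pass to the limit in the compact-open topology. -/
theorem ContinuousMap.apply_apply_of_tendsto {X : Type*} [TopologicalSpace X] {U : Set X}
    [LocallyCompactSpace U] [T2Space X] {ι : Type*} {l : Filter ι} [l.NeBot]
    {f g : ι → C(U, X)} {f₀ g₀ : C(U, X)} (hf : Tendsto f l (𝓝 f₀)) (hg : Tendsto g l (𝓝 g₀))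
    (hfU : ∀ i z, f i z ∈ U) (hgf : ∀ i z, g i ⟨f i z, hfU i z⟩ = z) (z : U)
    (hz : f₀ z ∈ U) : g₀ ⟨f₀ z, hz⟩ = z := by
  have h₁ : Tendsto (fun i ↦ (⟨f i z, hfU i z⟩ : U)) l (𝓝 ⟨f₀ z, hz⟩) :=
    tendsto_subtype_rng.2 (hf.eval_const z)
  have h₂ := hg.eval h₁
  simp only [hgf] at h₂
  exact tendsto_nhds_unique h₂ tendsto_const_nhds

/-- The automorphism group of a bounded open set is compact if its orbits have no accumulation
point on the boundary. -/
theorem AutRestrictions.isCompact_of_not_exists_tendsto_frontier (hΩ : IsOpen Ω)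
    (hbdd : Bornology.IsBounded Ω)
    (horbit : ¬ ∃ P ∈ Ω, ∃ X ∈ frontier Ω, ∃ φ : ℕ → (Fin n → ℂ) → (Fin n → ℂ),
      (∀ j, DifferentiableOn ℂ (φ j) Ω ∧ BijOn (φ j) Ω Ω) ∧
      Tendsto (fun j ↦ φ j P) atTop (𝓝 X)) :
    IsCompact (AutRestrictions n Ω) := by
  have : LocallyCompactSpace Ω := hΩ.locallyCompactSpace
  have hcomp : IsCompact (closure (AutRestrictions n Ω)) :=
    isCompact_closure_of_mapsTo_isBounded hΩ hbdd fun k ⟨φ, hφd, hφ, hkφ⟩ ↦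
      ⟨φ, hφd, hφ.mapsTo, hkφ⟩
  suffices h : IsClosed (AutRestrictions n Ω) by rwa [h.closure_eq] at hcomp
  refine isClosed_of_closure_subset fun f hf ↦ ?_
  rw [mem_closure_iff_comap_neBot] at hf
  set l : Ultrafilter (AutRestrictions n Ω) := Ultrafilter.of (comap (↑) (𝓝 f)) with hl
  have hlf : Tendsto ((↑) : AutRestrictions n Ω → C(Ω, Fin n → ℂ)) l (𝓝 f) :=
    tendsto_comap.mono_left (Ultrafilter.of_le _)
  choose inv hinv hinv_iff using fun k : AutRestrictions n Ω ↦ exists_inverse hΩ k.2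
  obtain ⟨g, -, hlg⟩ := hcomp.ultrafilter_le_nhds (l.map inv)
    (le_principal_iff.2 (mem_map.2 (univ_mem' fun k ↦ subset_closure (hinv k))))
  have hlg : Tendsto inv l (𝓝 g) := hlg
  have hfΩ := apply_mem_of_tendsto hΩ horbit (fun k ↦ k.2) hlf
  have hgΩ := apply_mem_of_tendsto hΩ horbit hinv hlg
  have hgf (z : Ω) : g ⟨f z, hfΩ z⟩ = z :=
    ContinuousMap.apply_apply_of_tendsto hlf hlg (fun k z ↦ apply_mem k.2 z)
      (fun k z ↦ (hinv_iff k z _).1 rfl) z (hfΩ z)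
  have hfg (z : Ω) : f ⟨g z, hgΩ z⟩ = z :=
    ContinuousMap.apply_apply_of_tendsto hlg hlf (fun k z ↦ apply_mem (hinv k) z)
      (fun k z ↦ (hinv_iff k _ z).2 rfl) z (hgΩ z)
  choose φ hφd hφ hkφ using fun k : AutRestrictions n Ω ↦ k.2
  classical
  set φ₀ : (Fin n → ℂ) → (Fin n → ℂ) := fun z ↦ if hz : z ∈ Ω then f ⟨z, hz⟩ else 0 with hφ₀
  have hfφ₀ (z : Ω) : f z = φ₀ z := by simp [hφ₀]
  refine ⟨φ₀, .of_tendsto_continuousMap hΩ hlf hφd hkφ hfφ₀,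
    ⟨fun z hz ↦ hfφ₀ ⟨z, hz⟩ ▸ hfΩ _, fun z hz w hw hzw ↦ ?_, fun z hz ↦
      ⟨g ⟨z, hz⟩, hgΩ _, (hfφ₀ ⟨_, hgΩ _⟩).symm.trans (hfg ⟨z, hz⟩)⟩⟩, hfφ₀⟩
  have h : f ⟨z, hz⟩ = f ⟨w, hw⟩ := by rw [hfφ₀, hfφ₀, hzw]
  refine (hgf ⟨z, hz⟩).symm.trans (Eq.trans ?_ (hgf ⟨w, hw⟩))
  simp only [h]

end Automorphisms

end

/-- H. Cartan's criterion: for a bounded domain `Ω ⊆ ℂⁿ`, the automorphism group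
(as a subset of `C(Ω, ℂⁿ)` with the compact-open topology) fails to be compact
iff there are `P ∈ Ω`, a boundary point `X ∈ ∂Ω`, and a sequence of automorphisms
`φⱼ` with `φⱼ(P) → X`. -/
theorem cartan_noncompactness_criterion (n : ℕ) (Ω : Set (Fin n → ℂ))
    (hopen : IsOpen Ω) (hconn : IsConnected Ω) (hbdd : Bornology.IsBounded Ω) :
    ¬ IsCompact (AutRestrictions n Ω) ↔
      ∃ P ∈ Ω, ∃ X ∈ frontier Ω, ∃ φ : ℕ → (Fin n → ℂ) → (Fin n → ℂ),
        (∀ j, DifferentiableOn ℂ (φ j) Ω ∧ Set.BijOn (φ j) Ω Ω) ∧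
        Filter.Tendsto (fun j => φ j P) Filter.atTop (nhds X) := by
  refine ⟨fun h ↦ by_contra fun horbit ↦
    h (AutRestrictions.isCompact_of_not_exists_tendsto_frontier hopen hbdd horbit), ?_⟩
  rintro ⟨P, hP, X, hX, φ, hφ, hlim⟩ hcomp
  rw [hopen.frontier_eq] at hX
  have hK := hcomp.image (ContinuousEvalConst.continuous_eval_const (⟨P, hP⟩ : Ω))
  have hmem : X ∈ (fun f : C(Ω, Fin n → ℂ) ↦ f ⟨P, hP⟩) '' AutRestrictions n Ω :=
    hK.isClosed.mem_of_tendsto hlim (Filter.Eventually.of_forall fun j ↦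
      ⟨⟨fun z ↦ φ j z, (hφ j).1.continuousOn.domRestrict⟩, ⟨φ j, (hφ j).1, (hφ j).2, fun _ ↦ rfl⟩,
        rfl⟩)
  obtain ⟨f, hf, rfl⟩ := hmem
  exact hX.2 (AutRestrictions.apply_mem hf _)
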